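/- arXiv:1204.0665 — 3 statements merged into one kernel-verified Lean document; each statement's English description precedes it below -/
import Mathlib

section
/- For any symmetric matrix X ∈ S_n, any ε ≥ 0 and any k ≥ 1, if z_1,...,z_k are i.i.d. standard Gaussian vectors in R^n, then λ_max(X) + ε/n ≤ E[max_{i=1..k} λ_max(X + (ε/n) z_i z_i^T)] ≤ λ_max(X) + c_k ε, where c_k = E[max_{i=1..k} ‖z_i‖²/n] ≤ k. -/
open MeasureTheory ProbabilityTheory Matrix
open scoped Classical

noncomputable def stdGaussian (n : ℕ) : Measure (Fin n → ℝ) :=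
  Measure.pi fun _ => gaussianReal 0 1

instance (n : ℕ) : IsProbabilityMeasure (stdGaussian n) :=
  inferInstanceAs (IsProbabilityMeasure (Measure.pi fun _ : Fin n => gaussianReal 0 1))

theorem symPart_isHermitian {n : ℕ} (X : Matrix (Fin n) (Fin n) ℝ) :
    ((2⁻¹ : ℝ) • (X + Xᵀ)).IsHermitian := by
  unfold Matrix.IsHermitian
  ext i j
  simp [Matrix.conjTranspose_apply, Matrix.transpose_apply, Matrix.add_apply]
  ring

/-- The eigenvalues (with multiplicity) of a real symmetric matrix, read off the
symmetric part `(X + Xᵀ)/2` so as to be defined for every matrix. -/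
noncomputable def eigs {n : ℕ} (X : Matrix (Fin n) (Fin n) ℝ) : Fin n → ℝ :=
  (symPart_isHermitian X).eigenvalues

/-- Largest eigenvalue `λ_max`. -/
noncomputable def lamMax {n : ℕ} (X : Matrix (Fin n) (Fin n) ℝ) : ℝ :=
  ⨆ i, eigs X i

/-- Second largest eigenvalue (with multiplicity) `λ₂`. -/
noncomputable def lam2 {n : ℕ} (X : Matrix (Fin n) (Fin n) ℝ) : ℝ :=
  ⨅ i, ⨆ j : {j : Fin n // j ≠ i}, eigs X j

/-- Multiplicity of the largest eigenvalue. -/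
noncomputable def lamMaxMult {n : ℕ} (X : Matrix (Fin n) (Fin n) ℝ) : ℕ :=
  (Finset.univ.filter fun i => eigs X i = lamMax X).card

theorem parseval {n : ℕ} {A : Matrix (Fin n) (Fin n) ℝ} (hA : A.IsHermitian) (v y : Fin n → ℝ) :
    ∑ i, ((hA.eigenvectorBasis i).ofLp ⬝ᵥ v) * ((hA.eigenvectorBasis i).ofLp ⬝ᵥ y) = v ⬝ᵥ y := by
  have h := hA.eigenvectorBasis.sum_inner_mul_inner (WithLp.toLp 2 v) (WithLp.toLp 2 y)
  simp only [EuclideanSpace.inner_eq_star_dotProduct, star_trivial] at h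
  rw [dotProduct_comm v y, ← h]
  refine Finset.sum_congr rfl fun i _ => ?_
  rw [dotProduct_comm _ y]

theorem quad_sym {n : ℕ} (X : Matrix (Fin n) (Fin n) ℝ) (v : Fin n → ℝ) :
    v ⬝ᵥ (((2⁻¹ : ℝ) • (X + Xᵀ)) *ᵥ v) = v ⬝ᵥ (X *ᵥ v) := by
  have : v ⬝ᵥ (Xᵀ *ᵥ v) = v ⬝ᵥ (X *ᵥ v) := by
    rw [mulVec_transpose, dotProduct_comm, ← dotProduct_mulVec]
  rw [smul_mulVec, add_mulVec, dotProduct_smul, dotProduct_add, this, smul_eq_mul]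
  ring

theorem quad_le {n : ℕ} (X : Matrix (Fin n) (Fin n) ℝ) (v : Fin n → ℝ) :
    v ⬝ᵥ (X *ᵥ v) ≤ lamMax X * (v ⬝ᵥ v) := by
  rw [← quad_sym]
  have hA := symPart_isHermitian X
  rw [← parseval hA, ← parseval hA v v, Finset.mul_sum]
  refine Finset.sum_le_sum fun i _ => ?_
  have h1 : (hA.eigenvectorBasis i).ofLp ⬝ᵥ (((2⁻¹ : ℝ) • (X + Xᵀ)) *ᵥ v) =
      eigs X i * ((hA.eigenvectorBasis i).ofLp ⬝ᵥ v) := by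
    rw [dotProduct_mulVec, ← mulVec_transpose, ← conjTranspose_eq_transpose_of_trivial, hA.eq,
      hA.mulVec_eigenvectorBasis, smul_dotProduct]
    rfl
  rw [h1]
  have h2 : eigs X i ≤ lamMax X := le_ciSup (Set.finite_range _).bddAbove i
  nlinarith [mul_self_nonneg ((hA.eigenvectorBasis i).ofLp ⬝ᵥ v)]

theorem quad_ex {n : ℕ} (hn : 0 < n) (X : Matrix (Fin n) (Fin n) ℝ) :
    ∃ u : Fin n → ℝ, u ⬝ᵥ u = 1 ∧ u ⬝ᵥ (X *ᵥ u) = lamMax X := by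
  have : Nonempty (Fin n) := ⟨⟨0, hn⟩⟩
  obtain ⟨i, hi⟩ := exists_eq_ciSup_of_finite (f := eigs X)
  have hA := symPart_isHermitian X
  have h1 : (hA.eigenvectorBasis i).ofLp ⬝ᵥ (hA.eigenvectorBasis i).ofLp = 1 := by
    have := hA.eigenvectorBasis.orthonormal.1 i
    have h2 := real_inner_self_eq_norm_sq (hA.eigenvectorBasis i)
    rw [this] at h2
    rw [EuclideanSpace.inner_eq_star_dotProduct, star_trivial] at h2
    rw [h2]; norm_num
  refine ⟨(hA.eigenvectorBasis i).ofLp, h1, ?_⟩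
  rw [← quad_sym, hA.mulVec_eigenvectorBasis, dotProduct_smul, h1, lamMax, ← hi]
  simp [eigs]

theorem lamMax_le_add {n : ℕ} (hn : 0 < n) (X Y : Matrix (Fin n) (Fin n) ℝ) :
    lamMax X ≤ lamMax Y + ∑ i, ∑ j, |X i j - Y i j| := by
  obtain ⟨u, hu, hX⟩ := quad_ex hn X
  have hY := quad_le Y u
  have hb : ∀ i, |u i| ≤ 1 := by
    intro i
    rw [← sq_le_one_iff_abs_le_one, ← hu, dotProduct, sq]
    exact Finset.single_le_sum (f := fun i => u i * u i) (fun i _ => mul_self_nonneg _)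
      (Finset.mem_univ i)
  have : u ⬝ᵥ ((X - Y) *ᵥ u) ≤ ∑ i, ∑ j, |X i j - Y i j| := by
    simp only [dotProduct, mulVec, Finset.mul_sum, Matrix.sub_apply]
    refine Finset.sum_le_sum fun i _ => Finset.sum_le_sum fun j _ => ?_
    refine (le_abs_self _).trans ?_
    rw [abs_mul, abs_mul]
    have h1 := hb i
    have h2 := hb j
    have : |X i j - Y i j| * |u j| ≤ |X i j - Y i j| := mul_le_of_le_one_right (abs_nonneg _) h2
    exact (mul_le_of_le_one_left (by positivity) h1).trans this
  rw [sub_mulVec, dotProduct_sub, hX] at this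
  rw [hu] at hY
  linarith

theorem lamMax_cont {n : ℕ} (hn : 0 < n) :
    Continuous (lamMax : Matrix (Fin n) (Fin n) ℝ → ℝ) := by
  rw [continuous_iff_continuousAt]
  intro X
  rw [ContinuousAt, tendsto_iff_dist_tendsto_zero]
  have hc : Continuous fun Y : Matrix (Fin n) (Fin n) ℝ => ∑ i, ∑ j, |X i j - Y i j| := by
    fun_prop
  have h0 := hc.tendsto X
  simp only [sub_self, abs_zero, Finset.sum_const_zero] at h0
  refine squeeze_zero (fun _ => dist_nonneg) (fun Y => ?_) h0
  rw [Real.dist_eq, abs_le]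
  have h1 := lamMax_le_add hn X Y
  have h2 := lamMax_le_add hn Y X
  simp only [fun i j => abs_sub_comm (Y i j) (X i j)] at h2
  constructor <;> linarith

theorem quad_rank {n : ℕ} (X : Matrix (Fin n) (Fin n) ℝ) (c : ℝ) (u z : Fin n → ℝ) :
    u ⬝ᵥ ((X + c • vecMulVec z z) *ᵥ u) = u ⬝ᵥ (X *ᵥ u) + c * (∑ j, u j * z j) ^ 2 := by
  rw [add_mulVec, smul_mulVec, dotProduct_add, dotProduct_smul, vecMulVec_mulVec]
  have h : z ⬝ᵥ u = ∑ j, u j * z j := dotProduct_comm z u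
  have h' : u ⬝ᵥ z = ∑ j, u j * z j := rfl
  rw [h, op_smul_eq_smul, dotProduct_smul, h', smul_eq_mul, smul_eq_mul, sq]

theorem lam_upper {n : ℕ} (hn : 0 < n) (X : Matrix (Fin n) (Fin n) ℝ) (c : ℝ) (hc : 0 ≤ c)
    (z : Fin n → ℝ) :
    lamMax (X + c • vecMulVec z z) ≤ lamMax X + c * ∑ j, z j ^ 2 := by
  obtain ⟨u, hu, h⟩ := quad_ex hn (X + c • vecMulVec z z)
  rw [← h, quad_rank]
  have h1 := quad_le X u
  rw [hu, mul_one] at h1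
  have h2 := Finset.sum_mul_sq_le_sq_mul_sq Finset.univ u z
  have h3 : ∑ i, u i ^ 2 = 1 := by rw [← hu]; simp [dotProduct, sq]
  rw [h3, one_mul] at h2
  have := mul_le_mul_of_nonneg_left h2 hc
  linarith

theorem lam_lower {n : ℕ} (X : Matrix (Fin n) (Fin n) ℝ) (c : ℝ)
    (z u : Fin n → ℝ) (hu : u ⬝ᵥ u = 1) (hX : u ⬝ᵥ (X *ᵥ u) = lamMax X) :
    lamMax X + c * (∑ j, u j * z j) ^ 2 ≤ lamMax (X + c • vecMulVec z z) := by
  have := quad_le (X + c • vecMulVec z z) u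
  rwa [quad_rank, hu, hX, mul_one] at this

theorem memLp_gauss : MemLp (fun x : ℝ => x) 2 (gaussianReal 0 1) := by
  exact memLp_id_gaussianReal 2

theorem memLp_coord {n : ℕ} (j : Fin n) :
    MemLp (fun z : Fin n → ℝ => z j) 2 (stdGaussian n) :=
  memLp_gauss.comp_measurePreserving (measurePreserving_eval (fun _ : Fin n => gaussianReal 0 1) j)

theorem memLp_lin {n : ℕ} (u : Fin n → ℝ) :
    MemLp (fun z : Fin n → ℝ => ∑ j, u j * z j) 2 (stdGaussian n) :=
  memLp_finsetSum _ fun j _ => (memLp_coord j).const_mul (u j)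

theorem integral_coord {n : ℕ} (j : Fin n) : ∫ z, z j ∂(stdGaussian n) = 0 := by
  have h := (measurePreserving_eval (fun _ : Fin n => gaussianReal 0 1) j)
  have h2 := integral_map (μ := stdGaussian n) h.measurable.aemeasurable
    (f := fun x : ℝ => x) (by fun_prop)
  rw [show Measure.map (Function.eval j) (stdGaussian n) = gaussianReal 0 1 from h.map_eq,
    integral_id_gaussianReal] at h2
  exact h2.symm

theorem integral_lin_sq {n : ℕ} (u : Fin n → ℝ) :
    ∫ z, (∑ j, u j * z j) ^ 2 ∂(stdGaussian n) = ∑ j, u j ^ 2 := by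
  have hv := variance_sum_pi (μ := fun _ : Fin n => gaussianReal 0 1)
    (X := fun j x => u j * x) (fun j => memLp_gauss.const_mul (u j))
  have h0 : ∫ z, (∑ j, u j * z j) ∂(stdGaussian n) = 0 := by
    rw [integral_finsetSum]
    · simp [integral_const_mul, integral_coord]
    · intro j _
      exact ((memLp_coord j).const_mul (u j)).integrable (by norm_num)
  have hs : (∑ i, fun ω : Fin n → ℝ => u i * ω i) = fun z : Fin n → ℝ => ∑ j, u j * z j := by
    ext z; simp
  rw [hs] at hv
  change Var[_; stdGaussian n] = _ at hv
  rw [variance_of_integral_eq_zero (memLp_lin u).aestronglyMeasurable.aemeasurable h0] at hv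
  rw [hv]
  refine Finset.sum_congr rfl fun j _ => ?_
  rw [variance_const_mul, variance_fun_id_gaussianReal]
  simp

theorem integral_sq {n : ℕ} (j : Fin n) : ∫ z, (z j) ^ 2 ∂(stdGaussian n) = 1 := by
  have := integral_lin_sq (Pi.single j (1 : ℝ))
  simpa [Pi.single_apply] using this

theorem integrable_sq {n : ℕ} (j : Fin n) :
    Integrable (fun z : Fin n → ℝ => (z j) ^ 2) (stdGaussian n) :=
  (memLp_coord j).integrable_sq

theorem integrable_nsq {n : ℕ} :
    Integrable (fun z : Fin n → ℝ => (∑ j, z j ^ 2) / n) (stdGaussian n) :=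
  (integrable_finsetSum _ fun j _ => integrable_sq j).div_const _

theorem integral_nsq {n : ℕ} (hn : 0 < n) :
    ∫ z : Fin n → ℝ, (∑ j, z j ^ 2) / n ∂(stdGaussian n) = 1 := by
  rw [integral_div, integral_finsetSum _ fun j _ => integrable_sq j]
  simp only [integral_sq]
  have : (n : ℝ) ≠ 0 := by positivity
  simp [this]

theorem mp_eval {n k : ℕ} (i : Fin k) :
    MeasurePreserving (fun z : Fin k → Fin n → ℝ => z i)
      (Measure.pi fun _ : Fin k => stdGaussian n) (stdGaussian n) :=
  measurePreserving_eval (fun _ : Fin k => stdGaussian n) i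

theorem integral_eval {n k : ℕ} (i : Fin k) (f : (Fin n → ℝ) → ℝ)
    (hf : Integrable f (stdGaussian n)) :
    ∫ z, f (z i) ∂(Measure.pi fun _ : Fin k => stdGaussian n) = ∫ z, f z ∂(stdGaussian n) := by
  have h := mp_eval (n := n) i
  have h1 := hf.aestronglyMeasurable
  rw [← h.map_eq] at h1
  have h2 := integral_map h.measurable.aemeasurable h1
  rw [h.map_eq] at h2
  exact h2.symm

theorem integrable_eval {n k : ℕ} (i : Fin k) (f : (Fin n → ℝ) → ℝ)
    (hf : Integrable f (stdGaussian n)) :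
    Integrable (fun z => f (z i)) (Measure.pi fun _ : Fin k => stdGaussian n) :=
  (mp_eval i).integrable_comp_of_integrable hf

theorem stmt0 {n k : ℕ} (hn : 0 < n) (hk : 1 ≤ k)
    (X : Matrix (Fin n) (Fin n) ℝ) (hX : X.IsHermitian) (ε : ℝ) (hε : 0 ≤ ε) :
    lamMax X + ε / n ≤
      (∫ z : Fin k → Fin n → ℝ,
        ⨆ i, lamMax (X + (ε / n) • Matrix.vecMulVec (z i) (z i))
        ∂(Measure.pi fun _ : Fin k => stdGaussian n)) ∧
    (∫ z : Fin k → Fin n → ℝ,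
        ⨆ i, lamMax (X + (ε / n) • Matrix.vecMulVec (z i) (z i))
        ∂(Measure.pi fun _ : Fin k => stdGaussian n)) ≤
      lamMax X +
        (∫ z : Fin k → Fin n → ℝ, ⨆ i, (∑ j, z i j ^ 2) / n
          ∂(Measure.pi fun _ : Fin k => stdGaussian n)) * ε ∧
    (∫ z : Fin k → Fin n → ℝ, ⨆ i, (∑ j, z i j ^ 2) / n
        ∂(Measure.pi fun _ : Fin k => stdGaussian n)) ≤ k := by
  have : Nonempty (Fin k) := ⟨⟨0, hk⟩⟩
  let i0 : Fin k := ⟨0, hk⟩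
  have hc : 0 ≤ ε / n := by positivity
  obtain ⟨u, hu, huX⟩ := quad_ex hn X
  have bdd : ∀ f : Fin k → ℝ, BddAbove (Set.range f) := fun f => (Set.finite_range f).bddAbove
  have hnn : ∀ (z : Fin k → Fin n → ℝ) (i : Fin k), 0 ≤ (∑ j, z i j ^ 2) / n := fun z i => by
    positivity
  have hS : Integrable (fun z : Fin k → Fin n → ℝ => ∑ i, (∑ j, z i j ^ 2) / n)
      (Measure.pi fun _ : Fin k => stdGaussian n) :=
    integrable_finsetSum _ fun i _ => integrable_eval i _ integrable_nsq
  have hle : ∀ z : Fin k → Fin n → ℝ,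
      ⨆ i, (∑ j, z i j ^ 2) / (n : ℝ) ≤ ∑ i, (∑ j, z i j ^ 2) / n := fun z =>
    ciSup_le fun i => Finset.single_le_sum (f := fun i => (∑ j, z i j ^ 2) / (n : ℝ))
      (fun i _ => hnn z i) (Finset.mem_univ i)
  have hM : Integrable (fun z : Fin k → Fin n → ℝ => ⨆ i, (∑ j, z i j ^ 2) / (n : ℝ))
      (Measure.pi fun _ : Fin k => stdGaussian n) := by
    refine hS.mono' ?_ (Filter.Eventually.of_forall fun z => ?_)
    · exact (Measurable.iSup fun i => by fun_prop).aestronglyMeasurable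
    · rw [Real.norm_of_nonneg ((hnn z i0).trans (le_ciSup (bdd fun i => (∑ j, z i j ^ 2) / (n : ℝ)) i0))]
      exact hle z
  have hup : ∀ z : Fin k → Fin n → ℝ,
      ⨆ i, lamMax (X + (ε / n) • Matrix.vecMulVec (z i) (z i)) ≤
        lamMax X + (⨆ i, (∑ j, z i j ^ 2) / (n : ℝ)) * ε := fun z => by
    refine ciSup_le fun i => (lam_upper hn X _ hc (z i)).trans ?_
    have h1 := le_ciSup (bdd fun i => (∑ j, z i j ^ 2) / (n : ℝ)) i
    have h2 := mul_le_mul_of_nonneg_right h1 hε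
    have h3 : ε / n * ∑ j, z i j ^ 2 = (∑ j, z i j ^ 2) / (n : ℝ) * ε := by ring
    rw [h3]
    linarith
  have hlo : ∀ z : Fin k → Fin n → ℝ, lamMax X + ε / n * (∑ j, u j * z i0 j) ^ 2 ≤
      ⨆ i, lamMax (X + (ε / n) • Matrix.vecMulVec (z i) (z i)) := fun z =>
    (lam_lower X _ (z i0) u hu huX).trans
      (le_ciSup (bdd fun i => lamMax (X + (ε / n) • Matrix.vecMulVec (z i) (z i))) i0)
  have hU : Integrable (fun z : Fin k → Fin n → ℝ =>
      lamMax X + (⨆ i, (∑ j, z i j ^ 2) / (n : ℝ)) * ε)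
      (Measure.pi fun _ : Fin k => stdGaussian n) :=
    (integrable_const _).add (hM.mul_const _)
  have hq := integrable_eval i0 _ (memLp_lin u).integrable_sq
  have hL : Integrable (fun z : Fin k → Fin n → ℝ =>
      lamMax X + ε / n * (∑ j, u j * z i0 j) ^ 2)
      (Measure.pi fun _ : Fin k => stdGaussian n) :=
    (integrable_const _).add (hq.const_mul _)
  have hF : Integrable (fun z : Fin k → Fin n → ℝ =>
      ⨆ i, lamMax (X + (ε / n) • Matrix.vecMulVec (z i) (z i)))
      (Measure.pi fun _ : Fin k => stdGaussian n) := by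
    refine integrable_of_le_of_le ?_ (Filter.Eventually.of_forall hlo)
      (Filter.Eventually.of_forall hup) hL hU
    refine (Measurable.iSup fun i => ?_).aestronglyMeasurable
    refine ((lamMax_cont hn).comp ?_).measurable
    have hv : Continuous fun z : Fin k → Fin n → ℝ => vecMulVec (z i) (z i) :=
      Continuous.matrix_vecMulVec (by fun_prop) (by fun_prop)
    exact continuous_const.add (hv.const_smul (ε / n))
  refine ⟨?_, ?_, ?_⟩
  · refine le_trans (le_of_eq ?_) (integral_mono hL hF hlo)
    rw [integral_add (integrable_const _) (hq.const_mul _), integral_const_mul,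
      integral_eval i0 _ (memLp_lin u).integrable_sq, integral_lin_sq]
    have h3 : ∑ i, u i ^ 2 = 1 := by rw [← hu]; simp [dotProduct, sq]
    simp [h3]
  · refine (integral_mono hF hU hup).trans (le_of_eq ?_)
    rw [integral_add (integrable_const _) (hM.mul_const _), integral_mul_const]
    simp
  · refine (integral_mono hM hS hle).trans (le_of_eq ?_)
    rw [integral_finsetSum _ fun i _ => integrable_eval i _ integrable_nsq]
    simp only [fun i => integral_eval (k := k) i _ (integrable_nsq (n := n)), integral_nsq hn]
    simp
end

section
/- Let X ∈ S_n be symmetric with eigenvalues λ_1 ≥ ... ≥ λ_n, where λ_1 has multiplicity one. Then the local Lipschitz constant (w.r.t. the Frobenius norm) of the gradient of λ_max at X equals 1/(λ_1(X) − λ_2(X)); equivalently, sup over symmetric Y with ‖Y‖_F = 1 of lim_{t→0} ∂²λ_max(X+tY)/∂t² equals 1/(λ_1(X) − λ_2(X)). -/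
open MeasureTheory ProbabilityTheory Matrix
open scoped Classical

open Filter Topology in
theorem exists_curve {E ι : Type*} [NormedAddCommGroup E] [InnerProductSpace ℝ E]
    [FiniteDimensional ℝ E] [Fintype ι] (A B : E →L[ℝ] E)
    (b : OrthonormalBasis ι ℝ E) (l : ι → ℝ) (hb : ∀ i, A (b i) = l i • b i)
    (hA : ∀ x y, inner ℝ (A x) y = inner ℝ x (A y))
    (i₀ : ι) (hl : ∀ j, j ≠ i₀ → l j < l i₀) :
    ∃ (μ : ℝ → ℝ) (v : ℝ → E), ContDiffAt ℝ 2 μ 0 ∧ ContDiffAt ℝ 2 v 0 ∧ μ 0 = l i₀ ∧ v 0 = b i₀ ∧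
      (∀ᶠ t in 𝓝 (0:ℝ), A (v t) + t • B (v t) = μ t • v t) ∧
      (∀ᶠ t in 𝓝 (0:ℝ), inner ℝ (b i₀) (v t) = 1) := by
  have : CompleteSpace E := FiniteDimensional.complete ℝ E
  set φ := b i₀ with hφ
  have hφφ : inner ℝ φ φ = 1 := by simp [hφ]
  let f : ℝ × (ℝ × E) → ℝ × E := fun p =>
    (inner ℝ φ p.2.2, A p.2.2 + p.1 • B p.2.2 - p.2.1 • p.2.2)
  let u : ℝ × (ℝ × E) := (0, (l i₀, φ))
  have hf : ContDiff ℝ 2 f := by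
    show ContDiff ℝ 2 fun p : ℝ × (ℝ × E) => (inner ℝ φ p.2.2, A p.2.2 + p.1 • B p.2.2 - p.2.1 • p.2.2)
    have h0 : ContDiff ℝ 2 fun p : ℝ × (ℝ × E) => inner ℝ φ p.2.2 :=
      contDiff_const.inner ℝ (contDiff_snd.comp contDiff_snd)
    refine h0.prodMk ?_
    fun_prop
  have hcd : ContDiffAt ℝ 2 f u := hf.contDiffAt
  have hfd : ∀ m : ℝ, ∀ w : E, (fderiv ℝ f u ∘L .inr ℝ ℝ (ℝ × E)) (m, w) =
      (inner ℝ φ w, A w - m • φ - l i₀ • w) := by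
    intro m w
    have h1 : HasFDerivAt f (fderiv ℝ f u) u := (hcd.differentiableAt (by norm_num)).hasFDerivAt
    have h2 : HasDerivAt (fun s : ℝ => u + s • ((0 : ℝ), (m, w))) (0, (m, w)) 0 := by
      simpa using ((hasDerivAt_id (0:ℝ)).smul_const ((0 : ℝ), (m, w))).const_add u
    have h3 : HasDerivAt (fun s : ℝ => f (u + s • ((0 : ℝ), (m, w)))) (fderiv ℝ f u (0, (m, w))) 0 := by
      have h1' : HasFDerivAt f (fderiv ℝ f u) (u + (0:ℝ) • ((0 : ℝ), (m, w))) := by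
        simpa using h1
      exact HasFDerivAt.comp_hasDerivAt (0:ℝ) h1' h2
    have h4 : HasDerivAt (fun s : ℝ => f (u + s • ((0 : ℝ), (m, w))))
       (inner ℝ φ w, A w - m • φ - l i₀ • w) 0 := by
      have e : (fun s : ℝ => f (u + s • ((0 : ℝ), (m, w)))) = fun s : ℝ =>
        (inner ℝ φ φ + s * inner ℝ φ w, A φ + s • A w - (l i₀ + s * m) • (φ + s • w)) := by
        funext s
        simp [f, u, inner_add_right, inner_smul_right]
      rw [e]
      refine HasDerivAt.prodMk ?_ ?_
      · simpa using ((hasDerivAt_id (0:ℝ)).mul_const (inner ℝ φ w)).const_add (inner ℝ φ φ)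
      · have h5 := ((hasDerivAt_id (0:ℝ)).smul_const (A w)).const_add (A φ)
        have h6 := ((hasDerivAt_id (0:ℝ)).mul_const m).const_add (l i₀)
        have h7 := ((hasDerivAt_id (0:ℝ)).smul_const w).const_add φ
        have h8 := h5.sub (h6.smul h7)
        refine h8.congr_deriv ?_
        simp
        abel
    simpa using h3.unique h4
  have hinv : (fderiv ℝ f u ∘L .inr ℝ ℝ (ℝ × E)).IsInvertible := by
    set L := fderiv ℝ f u ∘L .inr ℝ ℝ (ℝ × E) with hL
    have hinj : Function.Injective (L : (ℝ × E) →ₗ[ℝ] (ℝ × E)) := by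
      rw [injective_iff_map_eq_zero]
      rintro ⟨m, w⟩ h
      have h' := hfd m w
      rw [show L (m, w) = 0 from h] at h'
      have e1 : inner ℝ φ w = 0 := (congrArg Prod.fst h').symm
      have e2 : A w - m • φ - l i₀ • w = 0 := (congrArg Prod.snd h').symm
      have e3 : m = 0 := by
        have := congrArg (fun z => inner ℝ φ z) e2
        simp only [inner_sub_right, inner_smul_right, hφφ, e1, ← hA] at this
        rw [hφ, hb, ← hφ, inner_smul_left, e1] at this
        simpa using this
      have e4 : w = 0 := by
        rw [← b.sum_repr' w]
        refine Finset.sum_eq_zero fun j _ => ?_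
        suffices h : inner ℝ (b j) w = 0 by rw [h, zero_smul]
        by_cases hj : j = i₀
        · rw [hj]; exact e1
        · have := congrArg (fun z => inner ℝ (b j) z) e2
          simp only [inner_sub_right, inner_smul_right, e3, ← hA] at this
          rw [hb, inner_smul_left] at this
          simp at this
          have h9 : (l j - l i₀) * inner ℝ (b j) w = 0 := by linarith
          rcases mul_eq_zero.1 h9 with h | h
          · have := hl j hj; linarith
          · exact h
      simp [e3, e4]
    refine ⟨(LinearEquiv.ofInjectiveEndo _ hinj).toContinuousLinearEquiv, ?_⟩
    ext x <;> rfl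
  have h2 : (2 : WithTop ℕ∞) ≠ 0 := by norm_num
  let ψ := hcd.implicitFunction h2 hinv
  have hψ : ContDiffAt ℝ 2 ψ 0 := hcd.contDiffAt_implicitFunction h2 hinv
  have hψ0 : ψ 0 = (l i₀, φ) := hcd.implicitFunction_apply_self h2 hinv
  have hev : ∀ᶠ t in 𝓝 (0:ℝ), f (t, ψ t) = f u := hcd.eventually_apply_implicitFunction h2 hinv
  have hfu : f u = (1, 0) := by
    simp only [f, u, hφφ]
    rw [hφ, hb]; simp
  refine ⟨fun t => (ψ t).1, fun t => (ψ t).2, hψ.fst, hψ.snd, by simp [hψ0], by simp [hψ0], ?_, ?_⟩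
  · filter_upwards [hev] with t ht
    rw [hfu] at ht
    exact sub_eq_zero.1 (congrArg Prod.snd ht)
  · filter_upwards [hev] with t ht
    rw [hfu] at ht
    exact (congrArg Prod.fst ht)

open Filter Topology in
theorem second_deriv {E ι : Type*} [NormedAddCommGroup E] [InnerProductSpace ℝ E]
    [FiniteDimensional ℝ E] [Fintype ι] (A B : E →L[ℝ] E)
    (b : OrthonormalBasis ι ℝ E) (l : ι → ℝ) (hb : ∀ i, A (b i) = l i • b i)
    (hA : ∀ x y, inner ℝ (A x) y = inner ℝ x (A y))
    (hB : ∀ x y, inner ℝ (B x) y = inner ℝ x (B y))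
    (i₀ : ι) (hl : ∀ j, j ≠ i₀ → l j < l i₀) (μ : ℝ → ℝ) (v : ℝ → E)
    (hμ : ContDiffAt ℝ 2 μ 0) (hv : ContDiffAt ℝ 2 v 0) (hμ0 : μ 0 = l i₀) (hv0 : v 0 = b i₀)
    (h1 : ∀ᶠ t in 𝓝 (0:ℝ), A (v t) + t • B (v t) = μ t • v t)
    (h2 : ∀ᶠ t in 𝓝 (0:ℝ), inner ℝ (b i₀) (v t) = 1) :
    deriv (deriv μ) 0 = 2 * ∑ j, (inner ℝ (b j) (B (b i₀)))^2 / (l i₀ - l j) := by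
  have hvd : HasDerivAt v (deriv v 0) 0 := (hv.differentiableAt (by norm_num)).hasDerivAt
  have hμd : HasDerivAt μ (deriv μ 0) 0 := (hμ.differentiableAt (by norm_num)).hasDerivAt
  -- coefficients
  have hin : ∀ w : E, HasDerivAt (fun t => inner ℝ w (v t)) (inner ℝ w (deriv v 0)) 0 := by
    intro w
    simpa using (hasDerivAt_const (0:ℝ) w).inner ℝ hvd
  have hc : ∀ j, inner ℝ (b j) (deriv v 0) = inner ℝ (b j) (B (b i₀)) / (l i₀ - l j) := by
    intro j
    by_cases hj : j = i₀
    · subst hj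
      rw [sub_self, div_zero]
      refine (hin (b j)).unique ?_
      refine (hasDerivAt_const (0:ℝ) (1:ℝ)).congr_of_eventuallyEq ?_
      filter_upwards [h2] with t ht using ht
    · have e : (fun t => l j * inner ℝ (b j) (v t) + t * inner ℝ (B (b j)) (v t)) =ᶠ[𝓝 0]
          fun t => μ t * inner ℝ (b j) (v t) := by
        filter_upwards [h1] with t ht
        have := congrArg (fun z => inner ℝ (b j) z) ht
        simp only [inner_add_right, inner_smul_right, ← hA, ← hB, hb, inner_smul_left] at this
        simpa using this
      have d1 := ((hin (b j)).const_mul (l j)).add ((hasDerivAt_id (0:ℝ)).mul (hin (B (b j))))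
      have d2 := hμd.mul (hin (b j))
      have d3 := d1.unique (d2.congr_of_eventuallyEq e)
      have ho : inner ℝ (b j) (b i₀) = 0 := by simp [b.inner_eq_ite, hj]
      simp only [hv0, ho, hμ0, id, hB] at d3
      have := hl j hj
      rw [eq_div_iff (by linarith)]
      linarith
  -- the scalar function
  set g : ℝ → ℝ := fun t => inner ℝ (B (b i₀)) (v t) with hg
  have hgc : ContDiffAt ℝ 2 g 0 := contDiffAt_const.inner ℝ hv
  have hμg : μ =ᶠ[𝓝 0] fun t => l i₀ + t * g t := by
    filter_upwards [h1, h2] with t ht ht2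
    have := congrArg (fun z => inner ℝ (b i₀) z) ht
    simp only [inner_add_right, inner_smul_right, ← hA, ← hB, hb, inner_smul_left, ht2] at this
    simp at this
    simp [hg, this]
  have hgd : HasDerivAt g (inner ℝ (B (b i₀)) (deriv v 0)) 0 := hin _
  have hdev : deriv μ =ᶠ[𝓝 0] fun t => g t + t * deriv g t := by
    have hgev : ∀ᶠ t in 𝓝 (0:ℝ), DifferentiableAt ℝ g t := by
      filter_upwards [hgc.eventually (by norm_num)] with t ht using ht.differentiableAt (by norm_num)
    refine hμg.deriv.trans ?_
    filter_upwards [hgev] with t ht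
    have := (((hasDerivAt_id t).mul ht.hasDerivAt).const_add (l i₀)).deriv
    simpa using this
  have hg' : DifferentiableAt ℝ (deriv g) 0 := by
    have h5 : ContDiffAt ℝ 1 (fderiv ℝ g) 0 := ContDiffAt.fderiv_right hgc (by norm_num)
    have h6 : DifferentiableAt ℝ (fun t => fderiv ℝ g t 1) 0 :=
      (h5.differentiableAt (by norm_num)).clm_apply (differentiableAt_const _)
    exact h6
  rw [hdev.deriv_eq]
  have := (hgd.add ((hasDerivAt_id (0:ℝ)).mul hg'.hasDerivAt)).deriv
  have h3 : deriv (fun t => g t + t * deriv g t) 0 = 2 * inner ℝ (B (b i₀)) (deriv v 0) := by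
    refine Eq.trans this ?_
    rw [hgd.deriv]; simp; ring
  rw [h3, ← b.sum_inner_mul_inner]
  congr 1
  refine Finset.sum_congr rfl fun j _ => ?_
  rw [hc, real_inner_comm]; ring

/-- An eigenvalue close to the top one is the top one. -/
theorem top_eig_unique {E : Type*} [NormedAddCommGroup E] [InnerProductSpace ℝ E]
    (A B : E →L[ℝ] E)
    (hA : ∀ x y, inner ℝ (A x) y = inner ℝ x (A y))
    (hB : ∀ x y, inner ℝ (B x) y = inner ℝ x (B y)) (φ : E) (r : ℝ)
    (hr : ∀ w, inner ℝ φ w = 0 → inner ℝ w (A w) ≤ r * ‖w‖ ^ 2) (t μ ν : ℝ) (v u : E)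
    (hv : A v + t • B v = μ • v) (hu : A u + t • B u = ν • u) (hφ : inner ℝ φ v = 1)
    (hu0 : u ≠ 0) (hμ : r + |t| * ‖B‖ < μ) : ν ≤ μ := by
  by_contra! hlt
  have horth : inner ℝ v u = 0 := by
    have h1 : inner ℝ (A v + t • B v) u = inner ℝ v (A u + t • B u) := by
      simp [inner_add_left, inner_add_right, inner_smul_left, inner_smul_right, hA, hB]
    rw [hv, hu, inner_smul_left, inner_smul_right] at h1
    simp at h1
    rcases h1 with h | h
    · linarith
    · exact h
  set a := inner ℝ φ u with ha
  set w := a • v - u with hw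
  have hφw : inner ℝ φ w = 0 := by
    simp [hw, inner_sub_right, inner_smul_right, hφ, ha]
  have hun : 0 < ‖u‖ ^ 2 := by positivity
  have huv : inner ℝ u v = 0 := by rw [real_inner_comm]; exact horth
  have hwn : ‖w‖ ^ 2 = a ^ 2 * ‖v‖ ^ 2 + ‖u‖ ^ 2 := by
    rw [← real_inner_self_eq_norm_sq, ← real_inner_self_eq_norm_sq, ← real_inner_self_eq_norm_sq]
    simp only [hw, inner_sub_left, inner_sub_right, inner_smul_left, inner_smul_right, horth, huv]
    simp; ring
  have hq : inner ℝ w (A w) + t * inner ℝ w (B w) = μ * (a ^ 2 * ‖v‖ ^ 2) + ν * ‖u‖ ^ 2 := by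
    have : A w + t • B w = (a * μ) • v - ν • u := by
      rw [mul_smul, ← hv, ← hu, hw]; simp [smul_sub, smul_comm t a]; abel
    rw [← inner_smul_right, ← inner_add_right, this]
    rw [← real_inner_self_eq_norm_sq, ← real_inner_self_eq_norm_sq]
    simp only [hw, inner_sub_left, inner_sub_right, inner_smul_left, inner_smul_right, horth, huv]
    simp; ring
  have h1 := hr w hφw
  have h2 : t * inner ℝ w (B w) ≤ |t| * ‖B‖ * ‖w‖ ^ 2 := by
    calc t * inner ℝ w (B w) ≤ |t * inner ℝ w (B w)| := le_abs_self _
      _ = |t| * |inner ℝ w (B w)| := abs_mul _ _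
      _ ≤ |t| * (‖w‖ * (‖B‖ * ‖w‖)) := by
        gcongr
        exact (abs_real_inner_le_norm _ _).trans (by gcongr; exact B.le_opNorm w)
      _ = _ := by ring
  have h3 : 0 < ‖w‖ ^ 2 := by rw [hwn]; positivity
  have h4 := mul_lt_mul_of_pos_right hμ h3
  have h5 := mul_lt_mul_of_pos_right hlt hun
  have h6 : μ * ‖w‖ ^ 2 = μ * (a ^ 2 * ‖v‖ ^ 2) + μ * ‖u‖ ^ 2 := by rw [hwn]; ring
  linarith

theorem frob_basis {E ι κ : Type*} [NormedAddCommGroup E] [InnerProductSpace ℝ E]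
    [Fintype ι] [Fintype κ] (B : E →L[ℝ] E)
    (hB : ∀ x y, inner ℝ (B x) y = inner ℝ x (B y))
    (b : OrthonormalBasis ι ℝ E) (c : OrthonormalBasis κ ℝ E) :
    ∑ k, ∑ j, (inner ℝ (b k) (B (b j))) ^ 2 = ∑ k, ∑ j, (inner ℝ (c k) (B (c j))) ^ 2 := by
  have h1 : ∀ (x : E), ∑ k, (inner ℝ (b k) x) ^ 2 = ∑ k, (inner ℝ (c k) x) ^ 2 := by
    intro x
    have e1 := b.sum_sq_norm_inner_right x
    have e2 := c.sum_sq_norm_inner_right x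
    simp only [Real.norm_eq_abs, sq_abs] at e1 e2
    rw [e1, e2]
  rw [Finset.sum_comm]
  simp_rw [h1]
  rw [Finset.sum_comm]
  refine Finset.sum_congr rfl fun k _ => ?_
  have h2 : ∀ y, inner ℝ (c k) (B y) = inner ℝ y (B (c k)) := by
    intro y; rw [← hB, real_inner_comm]
  simp_rw [h2]
  exact h1 _

theorem eigs_eq {n : ℕ} {Z : Matrix (Fin n) (Fin n) ℝ} (hZ : Z.IsHermitian) :
    eigs Z = hZ.eigenvalues := by
  have h : ((2⁻¹ : ℝ) • (Z + Zᵀ)) = Z := by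
    have hT : Zᵀ = Z := by simpa using hZ.eq
    rw [hT, ← two_smul ℝ Z, smul_smul]; norm_num
  unfold eigs
  have : ∀ (W : Matrix (Fin n) (Fin n) ℝ) (hW : W.IsHermitian), W = Z →
      hW.eigenvalues = hZ.eigenvalues := by
    intro W hW e; subst e; rfl
  exact this _ _ h

theorem exists_eigbasis {n : ℕ} {Z : Matrix (Fin n) (Fin n) ℝ} (hZ : Z.IsHermitian) :
    ∃ b : OrthonormalBasis (Fin n) ℝ (EuclideanSpace ℝ (Fin n)),
      ∀ i, Matrix.toEuclideanCLM (𝕜 := ℝ) Z (b i) = eigs Z i • b i := by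
  refine ⟨hZ.eigenvectorBasis, fun i => ?_⟩
  apply WithLp.ofLp_injective
  rw [Matrix.ofLp_toEuclideanCLM, eigs_eq hZ]
  exact hZ.mulVec_eigenvectorBasis i

theorem clm_symm {n : ℕ} {Z : Matrix (Fin n) (Fin n) ℝ} (hZ : Z.IsHermitian) :
    ∀ x y, inner ℝ (Matrix.toEuclideanCLM (𝕜 := ℝ) Z x) y =
      inner ℝ x (Matrix.toEuclideanCLM (𝕜 := ℝ) Z y) :=
  Matrix.isSymmetric_toEuclideanLin_iff.mpr hZ

theorem frob_eq {n : ℕ} {Z : Matrix (Fin n) (Fin n) ℝ} (hZ : Z.IsHermitian)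
    (b : OrthonormalBasis (Fin n) ℝ (EuclideanSpace ℝ (Fin n))) :
    ∑ k, ∑ j, (inner ℝ (b k) (Matrix.toEuclideanCLM (𝕜 := ℝ) Z (b j))) ^ 2
      = ∑ i, ∑ j, Z i j ^ 2 := by
  rw [frob_basis _ (clm_symm hZ) b (EuclideanSpace.basisFun (Fin n) ℝ)]
  refine Finset.sum_congr rfl fun i _ => Finset.sum_congr rfl fun j _ => ?_
  congr 1
  simp [Matrix.inner_toEuclideanCLM]

theorem eigs_le_lamMax {n : ℕ} (Z : Matrix (Fin n) (Fin n) ℝ) (i : Fin n) :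
    eigs Z i ≤ lamMax Z :=
  le_ciSup (f := eigs Z) (Set.finite_range _).bddAbove i

theorem exists_lamMax {n : ℕ} (hn : 2 ≤ n) (Z : Matrix (Fin n) (Fin n) ℝ) :
    ∃ i, eigs Z i = lamMax Z := by
  have : Nonempty (Fin n) := ⟨⟨0, by omega⟩⟩
  exact exists_eq_ciSup_of_finite

theorem top_structure {n : ℕ} (hn : 2 ≤ n) (X : Matrix (Fin n) (Fin n) ℝ)
    (hmult : lamMaxMult X = 1) :
    ∃ i₀ j₁ : Fin n, j₁ ≠ i₀ ∧ eigs X i₀ = lamMax X ∧ eigs X j₁ = lam2 X ∧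
      eigs X j₁ < eigs X i₀ ∧ ∀ j, j ≠ i₀ → eigs X j ≤ eigs X j₁ := by
  have hne : Nontrivial (Fin n) := Fin.nontrivial_iff_two_le.2 hn
  have hsub : ∀ i : Fin n, Nonempty {j : Fin n // j ≠ i} := fun i => by
    obtain ⟨j, hj⟩ := exists_ne i
    exact ⟨⟨j, hj⟩⟩
  obtain ⟨i₀, hi₀⟩ := Finset.card_eq_one.1 hmult
  have hmem : ∀ j, eigs X j = lamMax X ↔ j = i₀ := by
    intro j
    have := Finset.ext_iff.1 hi₀ j
    simpa using this
  have htop : eigs X i₀ = lamMax X := (hmem i₀).2 rfl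
  have hlt : ∀ j, j ≠ i₀ → eigs X j < lamMax X := fun j hj =>
    lt_of_le_of_ne (eigs_le_lamMax X j) fun h => hj ((hmem j).1 h)
  obtain ⟨⟨j₁, hj₁⟩, hs⟩ :=
    exists_eq_ciSup_of_finite (f := fun j : {j : Fin n // j ≠ i₀} => eigs X j)
  have hle : ∀ j, j ≠ i₀ → eigs X j ≤ eigs X j₁ := by
    intro j hj
    have h1 := le_ciSup (f := fun j : {j : Fin n // j ≠ i₀} => eigs X j)
      (Set.finite_range _).bddAbove ⟨j, hj⟩
    rw [← hs] at h1
    exact h1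
  refine ⟨i₀, j₁, hj₁, htop, ?_, htop ▸ hlt j₁ hj₁, hle⟩
  unfold lam2
  apply le_antisymm
  · refine le_ciInf fun i => ?_
    by_cases hi : i = i₀
    · subst hi; exact hs.le
    · have h1 := le_ciSup (f := fun j : {j : Fin n // j ≠ i} => eigs X j)
        (Set.finite_range _).bddAbove ⟨i₀, Ne.symm hi⟩
      exact (hlt j₁ hj₁).le.trans (htop ▸ h1)
  · refine (ciInf_le (Set.finite_range _).bddBelow i₀).trans ?_
    exact hs.ge

open Filter Topology in
theorem lamMax_second_deriv {n : ℕ} (hn : 2 ≤ n) {X Y : Matrix (Fin n) (Fin n) ℝ}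
    (hX : X.IsHermitian) (hY : Y.IsHermitian)
    (b : OrthonormalBasis (Fin n) ℝ (EuclideanSpace ℝ (Fin n)))
    (hb : ∀ i, Matrix.toEuclideanCLM (𝕜 := ℝ) X (b i) = eigs X i • b i)
    (i₀ j₁ : Fin n) (hlt : eigs X j₁ < eigs X i₀) (hle : ∀ j, j ≠ i₀ → eigs X j ≤ eigs X j₁) :
    deriv (deriv fun t : ℝ => lamMax (X + t • Y)) 0 =
      2 * ∑ j, (inner ℝ (b j) (Matrix.toEuclideanCLM (𝕜 := ℝ) Y (b i₀))) ^ 2 /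
        (eigs X i₀ - eigs X j) := by
  set A := Matrix.toEuclideanCLM (𝕜 := ℝ) X with hAdef
  set B := Matrix.toEuclideanCLM (𝕜 := ℝ) Y with hBdef
  have hA := clm_symm hX
  have hB := clm_symm hY
  have hl : ∀ j, j ≠ i₀ → eigs X j < eigs X i₀ := fun j hj => (hle j hj).trans_lt hlt
  obtain ⟨μ, v, hμ, hv, hμ0, hv0, h1, h2⟩ := exists_curve A B b (eigs X) hb hA i₀ hl
  rw [← second_deriv A B b (eigs X) hb hA hB i₀ hl μ v hμ hv hμ0 hv0 h1 h2]
  have hr : ∀ w, inner ℝ (b i₀) w = 0 → inner ℝ w (A w) ≤ eigs X j₁ * ‖w‖ ^ 2 := by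
    intro w hw
    rw [← b.sum_inner_mul_inner, ← b.sum_sq_norm_inner_right w, Finset.mul_sum]
    refine Finset.sum_le_sum fun j _ => ?_
    rw [← hA, hb, inner_smul_left, real_inner_comm (b j) w]
    by_cases hj : j = i₀
    · subst hj; simp [hw]
    · have := hle j hj
      simp only [Real.norm_eq_abs, sq_abs, conj_trivial]
      nlinarith [sq_nonneg (inner ℝ (b j) w)]
  have hev : (fun t : ℝ => lamMax (X + t • Y)) =ᶠ[𝓝 0] μ := by
    have hcont : ContinuousAt (fun t => μ t - |t| * ‖B‖) 0 :=
      hμ.continuousAt.sub (by fun_prop)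
    have hgt : ∀ᶠ t in 𝓝 (0:ℝ), eigs X j₁ < μ t - |t| * ‖B‖ := by
      refine hcont.eventually_const_lt ?_
      simpa [hμ0] using hlt
    filter_upwards [h1, h2, hgt] with t ht1 ht2 ht3
    have hZ : (X + t • Y).IsHermitian := by
      refine hX.add ?_
      rw [Matrix.IsHermitian, Matrix.conjTranspose_smul, hY.eq]; simp
    have hCLM : ∀ x, Matrix.toEuclideanCLM (𝕜 := ℝ) (X + t • Y) x = A x + t • B x := by
      intro x; rw [map_add, map_smul]; rfl
    obtain ⟨c, hc⟩ := exists_eigbasis hZ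
    apply le_antisymm
    · obtain ⟨i, hi⟩ := exists_lamMax hn (X + t • Y)
      refine top_eig_unique A B hA hB (b i₀) (eigs X j₁) hr t (μ t) _ (v t) (c i) ht1 ?_ ht2 ?_
        (by linarith)
      · rw [← hCLM, hc, hi]
      · exact c.orthonormal.ne_zero i
    · have hv0 : v t ≠ 0 := by
        intro h; rw [h] at ht2; simp at ht2
      obtain ⟨i, hi⟩ : ∃ i, inner ℝ (c i) (v t) ≠ 0 := by
        by_contra! h
        apply hv0
        rw [← c.sum_repr' (v t)]
        exact Finset.sum_eq_zero fun i _ => by rw [h i, zero_smul]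
      have h3 := clm_symm hZ (c i) (v t)
      rw [hc, hCLM, ht1, inner_smul_left, inner_smul_right] at h3
      have h4 : eigs (X + t • Y) i = μ t := mul_right_cancel₀ hi (by simpa using h3)
      rw [← h4]
      exact eigs_le_lamMax _ _
  exact (hev.deriv).deriv_eq

theorem stmt3 {n : ℕ} (hn : 2 ≤ n) (X : Matrix (Fin n) (Fin n) ℝ) (hX : X.IsHermitian)
    (hmult : lamMaxMult X = 1) :
    sSup {g : ℝ | ∃ Y : Matrix (Fin n) (Fin n) ℝ, Y.IsHermitian ∧
        Real.sqrt (∑ i, ∑ j, Y i j ^ 2) = 1 ∧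
        g = deriv (deriv fun t : ℝ => lamMax (X + t • Y)) 0} =
      1 / (lamMax X - lam2 X) := by
  obtain ⟨i₀, j₁, hne, htop, hsec, hlt, hle⟩ := top_structure hn X hmult
  obtain ⟨b, hb⟩ := exists_eigbasis hX
  rw [← htop, ← hsec]
  have hgap : 0 < eigs X i₀ - eigs X j₁ := by linarith
  apply IsGreatest.csSup_eq
  constructor
  · set s : ℝ := (Real.sqrt 2)⁻¹ with hs
    have hs2 : s ^ 2 = 1 / 2 := by rw [hs, inv_pow, Real.sq_sqrt (by norm_num)]; norm_num
    let Y : Matrix (Fin n) (Fin n) ℝ :=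
      Matrix.of fun i j => s * (b i₀ i * b j₁ j + b j₁ i * b i₀ j)
    have hYH : Y.IsHermitian := by
      ext i j
      simp only [Y, Matrix.conjTranspose_apply, Matrix.of_apply, star_trivial]
      ring
    have hin : ∀ k l : Fin n, ∑ i, b k i * b l i = if k = l then 1 else 0 := by
      intro k l
      rw [← b.inner_eq_ite k l, PiLp.inner_apply]
      refine Finset.sum_congr rfl fun i _ => ?_
      simp [mul_comm]
    have hYb : Matrix.toEuclideanCLM (𝕜 := ℝ) Y (b i₀) = s • b j₁ := by
      ext i
      rw [Matrix.ofLp_toEuclideanCLM]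
      simp only [Matrix.mulVec, dotProduct, Y, Matrix.of_apply, PiLp.smul_apply, smul_eq_mul]
      have e : ∀ j, s * (b i₀ i * b j₁ j + b j₁ i * b i₀ j) * b i₀ j =
        s * b i₀ i * (b j₁ j * b i₀ j) + s * b j₁ i * (b i₀ j * b i₀ j) := fun j => by ring
      simp_rw [e]
      rw [Finset.sum_add_distrib, ← Finset.mul_sum, ← Finset.mul_sum, hin, hin]
      simp [hne]
    refine ⟨Y, hYH, ?_, ?_⟩
    · rw [Real.sqrt_eq_one]
      have e : ∀ i j, Y i j ^ 2 = s ^ 2 * ((b i₀ i * b i₀ i) * (b j₁ j * b j₁ j) +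
          (b j₁ i * b j₁ i) * (b i₀ j * b i₀ j) +
          2 * ((b i₀ i * b j₁ i) * (b i₀ j * b j₁ j))) := by
        intro i j; simp only [Y, Matrix.of_apply]; ring
      simp_rw [e, ← Finset.mul_sum, Finset.sum_add_distrib, ← Finset.mul_sum,
        ← Finset.sum_mul, hin]
      rw [hs2]
      simp [hne.symm]
      norm_num
    · rw [lamMax_second_deriv hn hX hYH b hb i₀ j₁ hlt hle, hYb, Finset.sum_eq_single j₁]
      · rw [inner_smul_right, b.inner_eq_ite]
        simp only [if_true, mul_one, hs2]
        field_simp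
      · intro j _ hj
        rw [inner_smul_right, b.inner_eq_ite]
        simp [hj]
      · simp
  · rintro g ⟨Y, hY, hF, rfl⟩
    rw [lamMax_second_deriv hn hX hY b hb i₀ j₁ hlt hle]
    rw [Real.sqrt_eq_one, ← frob_eq hY b] at hF
    set Q : Fin n → Fin n → ℝ := fun k j =>
      inner ℝ (b k) (Matrix.toEuclideanCLM (𝕜 := ℝ) Y (b j)) with hQ
    have hsym : ∀ k j, Q k j = Q j k := by
      intro k j
      simp only [hQ]
      rw [← clm_symm hY, real_inner_comm]
    have h1 : 2 * ∑ j ∈ Finset.univ.erase i₀, Q j i₀ ^ 2 ≤ 1 := by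
      have e1 : ∑ k, ∑ j, Q k j ^ 2 = ∑ j, Q i₀ j ^ 2 +
          ∑ k ∈ Finset.univ.erase i₀, ∑ j, Q k j ^ 2 :=
        (Finset.add_sum_erase _ _ (Finset.mem_univ i₀)).symm
      have e2 : ∑ j ∈ Finset.univ.erase i₀, Q j i₀ ^ 2 ≤ ∑ j, Q i₀ j ^ 2 := by
        simp_rw [hsym _ i₀]
        exact Finset.sum_le_sum_of_subset_of_nonneg (Finset.erase_subset _ _)
          fun _ _ _ => sq_nonneg _
      have e3 : ∑ j ∈ Finset.univ.erase i₀, Q j i₀ ^ 2 ≤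
          ∑ k ∈ Finset.univ.erase i₀, ∑ j, Q k j ^ 2 :=
        Finset.sum_le_sum fun k _ => Finset.single_le_sum (f := fun j => Q k j ^ 2)
          (fun _ _ => sq_nonneg _) (Finset.mem_univ i₀)
      have e4 : ∑ k, ∑ j, Q k j ^ 2 = 1 := hF
      linarith
    have h2 : ∑ j, Q j i₀ ^ 2 / (eigs X i₀ - eigs X j) ≤
        (∑ j ∈ Finset.univ.erase i₀, Q j i₀ ^ 2) / (eigs X i₀ - eigs X j₁) := by
      rw [← Finset.add_sum_erase _ _ (Finset.mem_univ i₀), sub_self, div_zero, zero_add,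
        Finset.sum_div]
      refine Finset.sum_le_sum fun j hj => ?_
      have := hle j (Finset.ne_of_mem_erase hj)
      exact div_le_div_of_nonneg_left (sq_nonneg _) hgap (by linarith)
    calc 2 * ∑ j, Q j i₀ ^ 2 / (eigs X i₀ - eigs X j)
        ≤ 2 * ((∑ j ∈ Finset.univ.erase i₀, Q j i₀ ^ 2) / (eigs X i₀ - eigs X j₁)) := by linarith
      _ = (2 * ∑ j ∈ Finset.univ.erase i₀, Q j i₀ ^ 2) / (eigs X i₀ - eigs X j₁) := by ring
      _ ≤ 1 / (eigs X i₀ - eigs X j₁) := by gcongr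
end

section
/- Suppose f : R^m → R is Lipschitz continuous with constant μ with respect to the Euclidean norm. Then the Gaussian-smoothed function sf(x) = E[f(x + ε z)], with z ∼ N(0, I_m) and ε > 0, is differentiable and its gradient is Lipschitz continuous with ‖∇sf(x) − ∇sf(y)‖₂ ≤ (2√m μ / ε) ‖x − y‖₂ for all x, y. -/
open MeasureTheory ProbabilityTheory

/-- The standard Gaussian measure `N(0, I_m)` on Euclidean space `ℝ^m`. -/
noncomputable def stdGaussianE (m : ℕ) : Measure (EuclideanSpace ℝ (Fin m)) :=
  (Measure.pi fun _ : Fin m => gaussianReal 0 1).map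
    (EuclideanSpace.equiv (Fin m) ℝ).symm

open scoped RealInnerProductSpace in
lemma aux_std (m : ℕ) : stdGaussianE m = stdGaussian (EuclideanSpace ℝ (Fin m)) :=
  map_pi_eq_stdGaussian (ι := Fin m)

lemma aux_real (a : ℝ) : gaussianReal a 1 =
    (gaussianReal 0 1).withDensity (fun x => ENNReal.ofReal (Real.exp (a * x - a ^ 2 / 2))) := by
  rw [gaussianReal_of_var_ne_zero _ one_ne_zero, gaussianReal_of_var_ne_zero _ one_ne_zero,
    ← withDensity_mul _ (measurable_gaussianPDF _ _) (by fun_prop)]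
  congr 1
  ext x
  simp only [gaussianPDF, Pi.mul_apply]
  rw [← ENNReal.ofReal_mul (gaussianPDFReal_nonneg _ _ _)]
  congr 1
  simp only [gaussianPDFReal]
  rw [mul_assoc (√_)⁻¹, ← Real.exp_add]
  congr 2
  simp
  ring

lemma aux_pi {m : ℕ} (a : Fin m → ℝ) :
    (Measure.pi fun i : Fin m => gaussianReal (a i) 1) =
    (Measure.pi fun _ : Fin m => gaussianReal 0 1).withDensity
      (fun x => ∏ i, ENNReal.ofReal (Real.exp (a i * x i - a i ^ 2 / 2))) := by
  apply Measure.pi_eq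
  intro s hs
  rw [withDensity_apply _ (MeasurableSet.univ_pi hs),
    ← lintegral_indicator (MeasurableSet.univ_pi hs)]
  have h1 : ∀ x : Fin m → ℝ, (Set.pi Set.univ s).indicator
      (fun x => ∏ i, ENNReal.ofReal (Real.exp (a i * x i - a i ^ 2 / 2))) x =
      ∏ i, (s i).indicator (fun t => ENNReal.ofReal (Real.exp (a i * t - a i ^ 2 / 2))) (x i) := by
    intro x
    by_cases hx : x ∈ Set.pi Set.univ s
    · rw [Set.indicator_of_mem hx]
      refine Finset.prod_congr rfl fun i _ => ?_
      rw [Set.indicator_of_mem (hx i (Set.mem_univ i))]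
    · rw [Set.indicator_of_notMem hx]
      simp only [Set.mem_pi, Set.mem_univ, true_imp_iff, not_forall] at hx
      obtain ⟨i, hi⟩ := hx
      symm
      apply Finset.prod_eq_zero (Finset.mem_univ i)
      rw [Set.indicator_of_notMem hi]
  simp_rw [h1]
  have hm : ∀ i, Measurable ((s i).indicator
      (fun t => ENNReal.ofReal (Real.exp (a i * t - a i ^ 2 / 2)))) :=
    fun i => Measurable.indicator (by fun_prop) (hs i)
  have hind : iIndepFun (fun i (x : Fin m → ℝ) => (s i).indicator
      (fun t => ENNReal.ofReal (Real.exp (a i * t - a i ^ 2 / 2))) (x i))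
      (Measure.pi fun _ : Fin m => gaussianReal 0 1) :=
    iIndepFun_pi (fun i => (hm i).aemeasurable)
  have h2 := lintegral_prod_eq_prod_lintegral_of_indepFun Finset.univ _ hind
    (fun i => (hm i).comp (measurable_pi_apply i))
  refine h2.trans ?_
  refine Finset.prod_congr rfl fun i _ => ?_
  have hp := measurePreserving_eval (fun _ : Fin m => gaussianReal 0 1) i
  rw [hp.lintegral_comp (hm i), lintegral_indicator (hs i), ← withDensity_apply _ (hs i),
    ← aux_real]

open scoped RealInnerProductSpace in
lemma aux_cm {m : ℕ} (a : EuclideanSpace ℝ (Fin m)) (g : EuclideanSpace ℝ (Fin m) → ℝ)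
    (hg : Continuous g) : ∫ z, g (z + a) ∂(stdGaussianE m) =
      ∫ z, Real.exp (⟪a, z⟫ - ‖a‖ ^ 2 / 2) * g z ∂(stdGaussianE m) := by
  have hme : Measurable (EuclideanSpace.equiv (Fin m) ℝ).symm :=
    (EuclideanSpace.equiv (Fin m) ℝ).symm.continuous.measurable
  have hce := (EuclideanSpace.equiv (Fin m) ℝ).symm.continuous
  unfold stdGaussianE
  rw [integral_map hme.aemeasurable (by fun_prop), integral_map hme.aemeasurable (by fun_prop)]
  have hmap : (Measure.pi fun _ : Fin m => gaussianReal 0 1).map (fun x i => x i + a i) =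
      Measure.pi fun i : Fin m => gaussianReal (a i) 1 := by
    rw [Measure.pi_map_pi (μ := fun _ : Fin m => gaussianReal 0 1)
      (f := fun i t => t + a i) (fun i => (measurable_id.add_const (a i)).aemeasurable)]
    congr 1
    ext1 i
    rw [gaussianReal_map_add_const, zero_add]
  have h1 : ∫ x, g ((EuclideanSpace.equiv (Fin m) ℝ).symm x + a)
        ∂(Measure.pi fun _ : Fin m => gaussianReal 0 1) =
      ∫ x, g ((EuclideanSpace.equiv (Fin m) ℝ).symm x)
        ∂(Measure.pi fun i : Fin m => gaussianReal (a i) 1) := by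
    have hms : Measurable (fun (x : Fin m → ℝ) (i : Fin m) => x i + a i) := by
      refine measurable_pi_lambda _ fun i => ?_
      have h : Measurable (fun x : Fin m → ℝ => x i) := measurable_pi_apply i
      exact h.add_const (a i)
    rw [← hmap, integral_map hms.aemeasurable (by fun_prop)]
    rfl
  rw [h1, aux_pi, integral_withDensity_eq_integral_toReal_smul (by fun_prop)
    (Filter.Eventually.of_forall fun x => by
      rw [← ENNReal.ofReal_prod_of_nonneg (fun i _ => (Real.exp_pos _).le)]
      exact ENNReal.ofReal_lt_top)]
  congr 1
  ext x
  rw [smul_eq_mul]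
  congr 1
  rw [← ENNReal.ofReal_prod_of_nonneg (fun i _ => (Real.exp_pos _).le),
    ENNReal.toReal_ofReal (Finset.prod_nonneg fun i _ => (Real.exp_pos _).le), ← Real.exp_sum]
  congr 1
  rw [EuclideanSpace.real_norm_sq_eq, Finset.sum_sub_distrib, Finset.sum_div, PiLp.inner_apply]
  congr 1
  refine Finset.sum_congr rfl fun i _ => ?_
  simp [mul_comm]

lemma aux_exp (m : ℕ) (c : ℝ) :
    Integrable (fun z => Real.exp (c * ‖z‖)) (stdGaussianE m) := by
  rw [aux_std]
  obtain ⟨C, hC, hi⟩ :=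
    IsGaussian.exists_integrable_exp_sq (stdGaussian (EuclideanSpace ℝ (Fin m)))
  refine Integrable.mono' (hi.const_mul (Real.exp (c ^ 2 / (4 * C)))) (by fun_prop) ?_
  refine Filter.Eventually.of_forall fun z => ?_
  rw [Real.norm_eq_abs, Real.abs_exp, ← Real.exp_add]
  apply Real.exp_le_exp.2
  have : c ^ 2 / (4 * C) + C * ‖z‖ ^ 2 - c * ‖z‖ = (c - 2 * C * ‖z‖) ^ 2 / (4 * C) := by
    field_simp
    ring
  have h2 : 0 ≤ (c - 2 * C * ‖z‖) ^ 2 / (4 * C) := by positivity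
  linarith

lemma aux_norm (m : ℕ) : ∫ z, ‖z‖ ∂(stdGaussianE m) ≤ Real.sqrt m := by
  have hprob : IsProbabilityMeasure (stdGaussianE m) := by rw [aux_std]; infer_instance
  have hL2 : MemLp (fun z : EuclideanSpace ℝ (Fin m) => ‖z‖) 2 (stdGaussianE m) := by
    rw [aux_std]; exact IsGaussian.memLp_two_id.norm
  have hsq : ∫ z, ‖z‖ ^ 2 ∂(stdGaussianE m) = m := by
    have hme : Measurable (EuclideanSpace.equiv (Fin m) ℝ).symm :=
      (EuclideanSpace.equiv (Fin m) ℝ).symm.continuous.measurable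
    unfold stdGaussianE
    rw [integral_map hme.aemeasurable (by fun_prop)]
    simp_rw [EuclideanSpace.real_norm_sq_eq]
    have hi : Integrable (fun x : ℝ => x ^ 2) (gaussianReal 0 1) :=
      (memLp_id_gaussianReal' 2 (by norm_num)).integrable_sq
    have hv : ∫ x : ℝ, x ^ 2 ∂(gaussianReal 0 1) = 1 := by
      have h := variance_id_gaussianReal (μ := 0) (v := 1)
      rw [variance_of_integral_eq_zero (by fun_prop) (by simp)] at h
      simpa using h
    rw [integral_finsetSum]
    · have : ∀ i : Fin m, ∫ x : Fin m → ℝ, ((EuclideanSpace.equiv (Fin m) ℝ).symm x i) ^ 2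
          ∂(Measure.pi fun _ : Fin m => gaussianReal 0 1) = 1 := by
        intro i
        rw [← hv]
        exact integral_comp_eval (μ := fun _ : Fin m => gaussianReal 0 1) (i := i)
          (f := fun t : ℝ => t ^ 2) (by fun_prop)
      rw [Finset.sum_congr rfl fun i _ => this i]
      simp
    · intro i _
      exact integrable_comp_eval (μ := fun _ : Fin m => gaussianReal 0 1) (i := i)
          (f := fun t : ℝ => t ^ 2) hi
  apply Real.le_sqrt_of_sq_le
  have h := variance_nonneg (fun z : EuclideanSpace ℝ (Fin m) => ‖z‖) (stdGaussianE m)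
  rw [variance_eq_sub hL2] at h
  have h' : ∫ z, ((fun z : EuclideanSpace ℝ (Fin m) => ‖z‖) ^ 2) z ∂(stdGaussianE m) = m := hsq
  rw [h'] at h
  linarith

open scoped RealInnerProductSpace in
lemma aux_deriv {m : ℕ} (f : EuclideanSpace ℝ (Fin m) → ℝ) (μ : ℝ) (hμ : 0 ≤ μ)
    (hf : ∀ x y, |f x - f y| ≤ μ * ‖x - y‖) (hc : Continuous f) (ε : ℝ) (hε : 0 < ε)
    (x₀ : EuclideanSpace ℝ (Fin m)) :
    Integrable (fun z => f (x₀ + ε • z) • innerSL ℝ z) (stdGaussianE m) ∧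
    HasFDerivAt (fun x => ∫ z, f (x + ε • z) ∂(stdGaussianE m))
      (ε⁻¹ • ∫ z, f (x₀ + ε • z) • innerSL ℝ z ∂(stdGaussianE m)) x₀ := by
  set K := |f x₀| + μ * ε with hK
  have hK0 : 0 ≤ K := by positivity
  have hfb : ∀ z : EuclideanSpace ℝ (Fin m), |f (x₀ + ε • z)| ≤ K * (1 + ‖z‖) := by
    intro z
    have h1 := hf (x₀ + ε • z) x₀
    rw [add_sub_cancel_left, norm_smul, Real.norm_of_nonneg hε.le] at h1
    have h2 := abs_sub_abs_le_abs_sub (f (x₀ + ε • z)) (f x₀)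
    have h3 : 0 ≤ |f x₀| * ‖z‖ := by positivity
    have h4 : 0 ≤ μ * ε := by positivity
    rw [hK]
    nlinarith
  have hexp1 : ∀ z : EuclideanSpace ℝ (Fin m), 1 + ‖z‖ ≤ Real.exp ‖z‖ := fun z => by
    linarith [Real.add_one_le_exp ‖z‖]
  have hexp3 : ∀ z : EuclideanSpace ℝ (Fin m),
      Real.exp ‖z‖ * (K * (1 + ‖z‖)) * (‖z‖ + 1) ≤ K * Real.exp (3 * ‖z‖) := by
    intro z
    have : Real.exp (3 * ‖z‖) = Real.exp ‖z‖ * Real.exp ‖z‖ * Real.exp ‖z‖ := by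
      rw [← Real.exp_add, ← Real.exp_add]; ring_nf
    rw [this]
    calc Real.exp ‖z‖ * (K * (1 + ‖z‖)) * (‖z‖ + 1)
        = K * (Real.exp ‖z‖ * (1 + ‖z‖) * (1 + ‖z‖)) := by ring
      _ ≤ _ := by gcongr <;> exact hexp1 z
  have hbi : Integrable (fun z => K * Real.exp (3 * ‖z‖)) (stdGaussianE m) :=
    (aux_exp m 3).const_mul K
  have hcl : Continuous (fun z : EuclideanSpace ℝ (Fin m) => f (x₀ + ε • z) • innerSL ℝ z) := by
    fun_prop
  have hI : Integrable (fun z => f (x₀ + ε • z) • innerSL ℝ z) (stdGaussianE m) := by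
    refine hbi.mono' hcl.aestronglyMeasurable (Filter.Eventually.of_forall fun z => ?_)
    rw [norm_smul, innerSL_apply_norm, Real.norm_eq_abs]
    refine le_trans ?_ (hexp3 z)
    have h1 : 1 ≤ Real.exp ‖z‖ := Real.one_le_exp (norm_nonneg _)
    have h0 : 0 ≤ K * (1 + ‖z‖) := by positivity
    calc |f (x₀ + ε • z)| * ‖z‖ ≤ (1 * (K * (1 + ‖z‖))) * (‖z‖ + 1) := by
          rw [one_mul]
          gcongr
          · exact hfb z
          · linarith
      _ ≤ _ := by gcongr
  refine ⟨hI, ?_⟩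
  have hF : HasFDerivAt (fun a : EuclideanSpace ℝ (Fin m) =>
      ∫ z, Real.exp (⟪a, z⟫ - ‖a‖ ^ 2 / 2) * f (x₀ + ε • z) ∂(stdGaussianE m))
      (∫ z, (Real.exp (⟪(0 : EuclideanSpace ℝ (Fin m)), z⟫ -
        ‖(0 : EuclideanSpace ℝ (Fin m))‖ ^ 2 / 2) * f (x₀ + ε • z)) •
          (innerSL ℝ z - innerSL ℝ 0) ∂(stdGaussianE m)) 0 := by
    refine hasFDerivAt_integral_of_dominated_of_fderiv_le
      (F' := fun a z => (Real.exp (⟪a, z⟫ - ‖a‖ ^ 2 / 2) * f (x₀ + ε • z)) •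
          (innerSL ℝ z - innerSL ℝ a))
      (bound := fun z => K * Real.exp (3 * ‖z‖))
      (Metric.closedBall_mem_nhds 0 one_pos)
      (Filter.Eventually.of_forall fun a => ?_) ?_ ?_ ?_ hbi ?_
    · exact Continuous.aestronglyMeasurable (by fun_prop)
    · refine hbi.mono' (Continuous.aestronglyMeasurable (by fun_prop))
        (Filter.Eventually.of_forall fun z => ?_)
      simp only [inner_zero_left, norm_zero]
      norm_num
      refine le_trans ?_ (hexp3 z)
      have h1 : 1 ≤ Real.exp ‖z‖ := Real.one_le_exp (norm_nonneg _)
      have h0 : 0 ≤ K * (1 + ‖z‖) := by positivity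
      calc |f (x₀ + ε • z)| ≤ (1 * (K * (1 + ‖z‖))) * 1 := by simpa using hfb z
        _ ≤ _ := by
          gcongr
          linarith [norm_nonneg z]
    · exact Continuous.aestronglyMeasurable (by fun_prop)
    · refine Filter.Eventually.of_forall fun z a ha => ?_
      have ha : ‖a‖ ≤ 1 := by simpa using ha
      rw [norm_smul, norm_mul, Real.norm_eq_abs, Real.norm_eq_abs, Real.abs_exp]
      refine le_trans ?_ (hexp3 z)
      have h0 : 0 ≤ K * (1 + ‖z‖) := by positivity
      gcongr
      · have := real_inner_le_norm a z
        nlinarith [norm_nonneg z, norm_nonneg a]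
      · exact hfb z
      · rw [← map_sub, innerSL_apply_norm]
        exact (norm_sub_le _ _).trans (by linarith)
    · refine Filter.Eventually.of_forall fun z a _ => ?_
      have h1 : HasFDerivAt (fun a : EuclideanSpace ℝ (Fin m) => ⟪a, z⟫) (innerSL ℝ z) a := by
        have := (innerSL ℝ z).hasFDerivAt (x := a)
        refine this.congr_of_eventuallyEq (Filter.Eventually.of_forall fun b => ?_)
        exact real_inner_comm _ _
      have h2 : HasFDerivAt (fun a : EuclideanSpace ℝ (Fin m) => ‖a‖ ^ 2 / 2) (innerSL ℝ a) a := by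
        have := (hasStrictFDerivAt_norm_sq a).hasFDerivAt.const_mul (1 / 2 : ℝ)
        have e : (fun a : EuclideanSpace ℝ (Fin m) => ‖a‖ ^ 2 / 2) =
            fun y => 1 / 2 * ‖y‖ ^ 2 := by ext b; ring
        rw [e]
        refine this.congr_fderiv ?_
        ext b
        simp
      have h3 := ((h1.sub h2).exp).mul_const (f (x₀ + ε • z))
      refine h3.congr_fderiv ?_
      rw [smul_smul, mul_comm]
      rfl
  have hF' : HasFDerivAt (fun a : EuclideanSpace ℝ (Fin m) =>
      ∫ z, Real.exp (⟪a, z⟫ - ‖a‖ ^ 2 / 2) * f (x₀ + ε • z) ∂(stdGaussianE m))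
      (∫ z, f (x₀ + ε • z) • innerSL ℝ z ∂(stdGaussianE m)) (ε⁻¹ • (x₀ - x₀)) := by
    simpa using hF
  have hs : HasFDerivAt (fun x : EuclideanSpace ℝ (Fin m) => ε⁻¹ • (x - x₀))
      (ε⁻¹ • ContinuousLinearMap.id ℝ (EuclideanSpace ℝ (Fin m))) x₀ :=
    ((hasFDerivAt_id x₀).sub_const x₀).const_smul ε⁻¹
  have hcomp := hF'.comp x₀ hs
  have heq : (fun x => ∫ z, f (x + ε • z) ∂(stdGaussianE m)) =
      (fun a : EuclideanSpace ℝ (Fin m) =>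
        ∫ z, Real.exp (⟪a, z⟫ - ‖a‖ ^ 2 / 2) * f (x₀ + ε • z) ∂(stdGaussianE m)) ∘
      (fun x => ε⁻¹ • (x - x₀)) := by
    ext x
    have h := aux_cm (ε⁻¹ • (x - x₀)) (fun z => f (x₀ + ε • z)) (by fun_prop)
    simp only [Function.comp]
    rw [← h]
    congr 1
    ext z
    congr 1
    rw [smul_add, smul_smul, mul_inv_cancel₀ hε.ne', one_smul]
    abel
  rw [heq]
  refine hcomp.congr_fderiv ?_
  rw [ContinuousLinearMap.comp_smul, ContinuousLinearMap.comp_id]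

theorem stmt8 {m : ℕ} (f : EuclideanSpace ℝ (Fin m) → ℝ) (μ : ℝ) (hμ : 0 ≤ μ)
    (hf : ∀ x y, |f x - f y| ≤ μ * ‖x - y‖) (ε : ℝ) (hε : 0 < ε) :
    Differentiable ℝ (fun x => ∫ z, f (x + ε • z) ∂(stdGaussianE m)) ∧
    ∀ x y,
      ‖fderiv ℝ (fun x => ∫ z, f (x + ε • z) ∂(stdGaussianE m)) x -
          fderiv ℝ (fun x => ∫ z, f (x + ε • z) ∂(stdGaussianE m)) y‖ ≤
        2 * Real.sqrt m * μ / ε * ‖x - y‖ := by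
  have hc : Continuous f := by
    refine (LipschitzWith.of_dist_le_mul (K := ⟨μ, hμ⟩) fun x y => ?_).continuous
    rw [Real.dist_eq, dist_eq_norm]
    exact hf x y
  have hd := aux_deriv f μ hμ hf hc ε hε
  refine ⟨fun x => (hd x).2.differentiableAt, fun x y => ?_⟩
  rw [(hd x).2.fderiv, (hd y).2.fderiv, ← smul_sub, ← integral_sub (hd x).1 (hd y).1, norm_smul,
    Real.norm_of_nonneg (inv_nonneg.2 hε.le)]
  have hin : Integrable (fun z : EuclideanSpace ℝ (Fin m) => ‖z‖) (stdGaussianE m) := by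
    rw [aux_std]; exact IsGaussian.integrable_id.norm
  have h1 : ‖∫ z, (f (x + ε • z) • innerSL ℝ z - f (y + ε • z) • innerSL ℝ z)
      ∂(stdGaussianE m)‖ ≤ ∫ z, μ * ‖x - y‖ * ‖z‖ ∂(stdGaussianE m) := by
    refine norm_integral_le_of_norm_le (hin.const_mul _) (Filter.Eventually.of_forall fun z => ?_)
    rw [← sub_smul, norm_smul, innerSL_apply_norm, Real.norm_eq_abs]
    gcongr
    simpa using hf (x + ε • z) (y + ε • z)
  rw [integral_const_mul] at h1
  have h2 : μ * ‖x - y‖ * ∫ z, ‖z‖ ∂(stdGaussianE m) ≤ μ * ‖x - y‖ * Real.sqrt m := by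
    gcongr
    exact aux_norm m
  have h3 : 0 ≤ ε⁻¹ * (μ * ‖x - y‖ * Real.sqrt m) := by positivity
  calc _ ≤ ε⁻¹ * (μ * ‖x - y‖ * Real.sqrt m) := by
        gcongr
        exact h1.trans h2
    _ ≤ 2 * (ε⁻¹ * (μ * ‖x - y‖ * Real.sqrt m)) := by linarith
    _ = _ := by ring
end
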